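/- If there exists an (α,β)-probabilistic representation (𝓑,P) of a bounded optimization problem OPT_q for databases of m elements, then the algorithm that samples B_i ∼ P and then applies the exponential mechanism over B_i with parameter ε (using score m·q(S,·)) is ε-differentially private and outputs, with probability at least 1 − β − β̂, a solution s with q(S,s) ≥ max_{f∈F} q(S,f) − α − α̂, provided m ≥ (2/(εα̂))·(size(𝓑) + ln(1/β̂)). -/

import Mathlib

open scoped Classical
noncomputable section

/-- The algorithm: sample a solution set `B i` with `i ∼ P`, then run the exponential
mechanism with score `m·q(S,·)` and parameter `ε` over `B i`. This is its output
distribution on solutions. -/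
def outDist {X F ι : Type*} [Fintype F] [Fintype ι] {m : ℕ}
    (P : ι → ℝ) (B : ι → Finset F) (q : (Fin m → X) → F → ℝ) (ε : ℝ)
    (S : Fin m → X) (f : F) : ℝ :=
  ∑ i, P i * (if f ∈ B i then
    Real.exp (ε * m * q S f / 2) / ∑ g ∈ B i, Real.exp (ε * m * q S g / 2) else 0)

/-- Changing every weight by a factor of at most `c` in either direction changes the normalized
weights by a factor of at most `c * c`. -/
theorem div_sum_le_mul_div_sum {F : Type*} (B : Finset F) (w w' : F → ℝ) (c : ℝ)
    (hw : ∀ f, 0 < w f) (hw' : ∀ f, 0 < w' f)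
    (h : ∀ f, w f ≤ c * w' f) (h' : ∀ f, w' f ≤ c * w f) {f : F} (hf : f ∈ B) :
    w f / ∑ g ∈ B, w g ≤ c * c * (w' f / ∑ g ∈ B, w' g) := by
  have hs : 0 < ∑ g ∈ B, w g := Finset.sum_pos (fun g _ => hw g) ⟨f, hf⟩
  have hs' : 0 < ∑ g ∈ B, w' g := Finset.sum_pos (fun g _ => hw' g) ⟨f, hf⟩
  have hss : ∑ g ∈ B, w' g ≤ c * ∑ g ∈ B, w g := by
    rw [Finset.mul_sum]
    exact Finset.sum_le_sum fun g _ => h' g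
  rw [← mul_div_assoc, div_le_div_iff₀ hs hs']
  calc w f * ∑ g ∈ B, w' g ≤ (c * w' f) * (c * ∑ g ∈ B, w g) :=
        mul_le_mul (h f) hss hs'.le ((hw f).le.trans (h f))
    _ = c * c * w' f * ∑ g ∈ B, w g := by ring

/-- The exponential mechanism over `B` with score `t * u` outputs an element of score at least
`u s - a`, where `s ∈ B`, except with probability at most `|B| * exp (-(t * a))`. -/
theorem one_sub_card_mul_exp_le_sum_filter {F : Type*} (B : Finset F) (u : F → ℝ) {t : ℝ} (a : ℝ)
    (ht : 0 ≤ t) {s : F} (hs : s ∈ B) :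
    1 - B.card * Real.exp (-(t * a)) ≤
      ∑ f ∈ B.filter (fun f => u s - a ≤ u f),
        Real.exp (t * u f) / ∑ g ∈ B, Real.exp (t * u g) := by
  set Z := ∑ g ∈ B, Real.exp (t * u g) with hZ
  have hZs : Real.exp (t * u s) ≤ Z :=
    Finset.single_le_sum (f := fun g => Real.exp (t * u g)) (fun g _ => (Real.exp_pos _).le) hs
  have hZpos : 0 < Z := (Real.exp_pos _).trans_le hZs
  have htotal : ∑ f ∈ B, Real.exp (t * u f) / Z = 1 := by
    rw [← Finset.sum_div, ← hZ, div_self hZpos.ne']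
  have hsplit := Finset.sum_filter_add_sum_filter_not B (fun f => u s - a ≤ u f)
    (fun f => Real.exp (t * u f) / Z)
  have hbad : ∑ f ∈ B.filter (fun f => ¬ u s - a ≤ u f), Real.exp (t * u f) / Z ≤
      B.card * Real.exp (-(t * a)) := by
    calc _ ≤ ∑ _f ∈ B.filter (fun f => ¬ u s - a ≤ u f), Real.exp (-(t * a)) := by
          refine Finset.sum_le_sum fun f hf => ?_
          have hlt := not_le.mp (Finset.mem_filter.mp hf).2
          rw [div_le_iff₀ hZpos]
          calc Real.exp (t * u f) ≤ Real.exp (-(t * a)) * Real.exp (t * u s) := by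
                rw [← Real.exp_add, Real.exp_le_exp]
                nlinarith [mul_le_mul_of_nonneg_left hlt.le ht]
            _ ≤ _ := mul_le_mul_of_nonneg_left hZs (Real.exp_pos _).le
      _ ≤ _ := by
          rw [Finset.sum_const, nsmul_eq_mul]
          gcongr
          exact Finset.filter_subset _ _
  linarith

/-- The output distribution gives a set `G` the average over `i ∼ P` of the mass that the
exponential mechanism over `B i` gives to it. -/
theorem sum_outDist {X F ι : Type*} [Fintype F] [Fintype ι] {m : ℕ}
    (P : ι → ℝ) (B : ι → Finset F) (q : (Fin m → X) → F → ℝ) (ε : ℝ)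
    (S : Fin m → X) (G : Finset F) :
    ∑ f ∈ G, outDist P B q ε S f =
      ∑ i, P i * ∑ f ∈ G, (if f ∈ B i then
        Real.exp (ε * m * q S f / 2) / ∑ g ∈ B i, Real.exp (ε * m * q S g / 2) else 0) := by
  simp only [outDist, Finset.mul_sum]
  exact Finset.sum_comm

/-- Neighboring databases have output distributions within a factor `exp ε` pointwise. -/
theorem outDist_le_exp_mul {X F ι : Type*} [Fintype F] [Fintype ι] {m : ℕ}
    (P : ι → ℝ) (hP : ∀ i, 0 ≤ P i) (B : ι → Finset F) (q : (Fin m → X) → F → ℝ) {ε : ℝ}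
    (hε : 0 < ε) {S S' : Fin m → X} (hq : ∀ f, |(m : ℝ) * q S f - (m : ℝ) * q S' f| ≤ 1)
    (f : F) : outDist P B q ε S f ≤ Real.exp ε * outDist P B q ε S' f := by
  have hexp : Real.exp ε = Real.exp (ε / 2) * Real.exp (ε / 2) := by
    rw [← Real.exp_add, add_halves]
  simp only [outDist]
  rw [Finset.mul_sum]
  refine Finset.sum_le_sum fun i _ => ?_
  rw [mul_left_comm]
  refine mul_le_mul_of_nonneg_left ?_ (hP i)
  split_ifs with hf
  · rw [hexp]
    refine div_sum_le_mul_div_sum (B i) (fun g => Real.exp (ε * m * q S g / 2))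
      (fun g => Real.exp (ε * m * q S' g / 2)) _ (fun _ => Real.exp_pos _)
      (fun _ => Real.exp_pos _) (fun g => ?_) (fun g => ?_) hf
    all_goals
      rw [← Real.exp_add, Real.exp_le_exp]
      obtain ⟨h₁, h₂⟩ := abs_le.mp (hq g)
      nlinarith [mul_le_mul_of_nonneg_left h₁ hε.le, mul_le_mul_of_nonneg_left h₂ hε.le]
  · simp

/-- The sample-size condition makes the failure bound of the exponential mechanism at most `b`. -/
theorem mul_exp_neg_le_of_log_le {n ε a b K m : ℝ} (hn : 0 < n) (hε : 0 < ε) (ha : 0 < a)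
    (hb : 0 < b) (hK : Real.log n ≤ K)
    (hm : (2 / (ε * a)) * (K + Real.log (1 / b)) ≤ m) :
    n * Real.exp (-(ε * m / 2 * a)) ≤ b := by
  have hpos : 0 < ε * a := mul_pos hε ha
  rw [div_mul_eq_mul_div, div_le_iff₀ hpos, one_div, Real.log_inv] at hm
  calc n * Real.exp (-(ε * m / 2 * a)) = Real.exp (Real.log n + -(ε * m / 2 * a)) := by
        rw [Real.exp_add, Real.exp_log hn]
    _ ≤ Real.exp (Real.log b) := Real.exp_le_exp.mpr (by linarith)
    _ = b := Real.exp_log hb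

/-- From a probabilistic representation of a bounded optimization problem to
a private approximation algorithm. If `(𝓑, P)` is an `(α,β)`-probabilistic representation
of the bounded optimization problem `OPT_q` for databases of `m` elements, then the
algorithm that samples `B i ∼ P` and applies the exponential mechanism over `B i` with
parameter `ε` (score `m·q(S,·)`) is ε-differentially private and outputs, with probability
at least `1 − β − β̂`, a solution `s` with `q(S,s) ≥ max_f q(S,f) − α − α̂`, provided
`m ≥ (2/(ε·α̂))·(size(𝓑) + ln(1/β̂))`. -/
theorem stmt_19 {X F ι : Type*} [Fintype F] [Nonempty F] [Fintype ι] (m : ℕ)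
    (q : (Fin m → X) → F → ℝ)
    (hq01 : ∀ S f, 0 ≤ q S f ∧ q S f ≤ 1)
    (hbounded : ∀ S S' : Fin m → X,
      (Finset.univ.filter (fun j => S j ≠ S' j)).card = 1 →
      ∀ f, |(m : ℝ) * q S f - (m : ℝ) * q S' f| ≤ 1)
    (ε α β αh βh K : ℝ)
    (hε : 0 < ε) (hα : 0 ≤ α) (hβ : 0 ≤ β) (hαh : 0 < αh) (hβh : 0 < βh)
    (P : ι → ℝ) (hP : ∀ i, 0 ≤ P i) (hP1 : ∑ i, P i = 1)
    (B : ι → Finset F) (hBne : ∀ i, (B i).Nonempty)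
    (hK : ∀ i, Real.log ((B i).card) ≤ K)
    (hrep : ∀ S : Fin m → X,
      1 - β ≤ ∑ i ∈ Finset.univ.filter (fun i : ι =>
        ∃ s ∈ B i, Finset.univ.sup' Finset.univ_nonempty (q S) - α ≤ q S s), P i)
    (hm : (2 / (ε * αh)) * (K + Real.log (1 / βh)) ≤ (m : ℝ)) :
    (∀ S S' : Fin m → X,
      (Finset.univ.filter (fun j => S j ≠ S' j)).card = 1 →
      ∀ G : Finset F,
        ∑ f ∈ G, outDist P B q ε S f ≤ Real.exp ε * ∑ f ∈ G, outDist P B q ε S' f) ∧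
    (∀ S : Fin m → X,
      1 - β - βh ≤ ∑ f ∈ Finset.univ.filter (fun f : F =>
          Finset.univ.sup' Finset.univ_nonempty (q S) - α - αh ≤ q S f),
        outDist P B q ε S f) := by
  refine ⟨fun S S' hSS' G => ?_, fun S => ?_⟩
  · rw [Finset.mul_sum]
    exact Finset.sum_le_sum fun f _ => outDist_le_exp_mul P hP B q hε (hbounded S S' hSS') f
  · rw [sum_outDist]
    set M := Finset.univ.sup' Finset.univ_nonempty (q S)
    set I := Finset.univ.filter (fun i : ι => ∃ s ∈ B i, M - α ≤ q S s)
    have hI1 : ∑ i ∈ I, P i ≤ 1 := hP1 ▸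
      Finset.sum_le_sum_of_subset_of_nonneg (Finset.subset_univ I) (fun i _ _ => hP i)
    have hnonneg : ∀ i f, 0 ≤ (if f ∈ B i then
        Real.exp (ε * m * q S f / 2) / ∑ g ∈ B i, Real.exp (ε * m * q S g / 2) else 0) := by
      intro i f
      split_ifs <;> positivity
    have hgood : ∀ i ∈ I, 1 - βh ≤
        ∑ f ∈ Finset.univ.filter (fun f : F => M - α - αh ≤ q S f), (if f ∈ B i then
          Real.exp (ε * m * q S f / 2) / ∑ g ∈ B i, Real.exp (ε * m * q S g / 2) else 0) := by
      intro i hi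
      obtain ⟨s, hs, hsM⟩ := (Finset.mem_filter.mp hi).2
      have hcard : (0 : ℝ) < (B i).card := by exact_mod_cast (hBne i).card_pos
      have hfail := mul_exp_neg_le_of_log_le hcard hε hαh hβh (hK i) hm
      have hmech := one_sub_card_mul_exp_le_sum_filter (B i) (q S) (t := ε * m / 2) αh
        (by positivity) hs
      simp only [div_mul_eq_mul_div (ε * (m : ℝ))] at hmech hfail
      rw [← Finset.sum_filter]
      refine (by linarith : _ ≤ _).trans (hmech.trans ?_)
      refine Finset.sum_le_sum_of_subset_of_nonneg (fun f hf => ?_) (fun f _ _ => by positivity)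
      simp only [Finset.mem_filter, Finset.mem_univ, true_and] at hf ⊢
      exact ⟨by linarith [hf.2], hf.1⟩
    calc 1 - β - βh ≤ (∑ i ∈ I, P i) * (1 - βh) := by nlinarith [hrep S]
      _ = ∑ i ∈ I, P i * (1 - βh) := Finset.sum_mul _ _ _
      _ ≤ _ := Finset.sum_le_sum fun i hi => mul_le_mul_of_nonneg_left (hgood i hi) (hP i)
      _ ≤ _ := Finset.sum_le_sum_of_subset_of_nonneg (Finset.subset_univ I)
          (fun i _ _ => mul_nonneg (hP i) (Finset.sum_nonneg fun f _ => hnonneg i f))
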